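/- arXiv:1607.07949 — 2 statements merged into one kernel-verified Lean document; each statement's English description precedes it below -/
import Mathlib

section
/- With the notation of the context (endomorphisms of Λ*(ℝ⁴), real numbers a,b with ab≠0, real parameter h, zeroth-order symbol p₀, and unit vector ξ' in the span of {e₁,e₂,e₃}), one has tr[c̃(ξ')∘p₀∘c̃(ξ')∘ι(e₄)] = −6a²bh. -/
open scoped BigOperators

noncomputable section

/-- The standard orthonormal basis vectors of `ℝ⁴`; `stdBasis 3` is `e₄`. -/
def stdBasis (i : Fin 4) : EuclideanSpace ℝ (Fin 4) := EuclideanSpace.single i 1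

/-- Left exterior multiplication `ε(v)` on the exterior algebra `Λ*(ℝ⁴)`. -/
def eps (v : EuclideanSpace ℝ (Fin 4)) :
    ExteriorAlgebra ℝ (EuclideanSpace ℝ (Fin 4)) →ₗ[ℝ]
      ExteriorAlgebra ℝ (EuclideanSpace ℝ (Fin 4)) :=
  LinearMap.mulLeft ℝ (ExteriorAlgebra.ι ℝ v)

/-- Interior multiplication (contraction) `ι(v)` with respect to the inner product. -/
def iot (v : EuclideanSpace ℝ (Fin 4)) :
    ExteriorAlgebra ℝ (EuclideanSpace ℝ (Fin 4)) →ₗ[ℝ]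
      ExteriorAlgebra ℝ (EuclideanSpace ℝ (Fin 4)) :=
  CliffordAlgebra.contractLeft ((innerSL ℝ v).toLinearMap)

/-- `c(v) = ε(v) - ι(v)`. -/
def cOp (v : EuclideanSpace ℝ (Fin 4)) := eps v - iot v

/-- `ĉ(v) = ε(v) + ι(v)`. -/
def cHat (v : EuclideanSpace ℝ (Fin 4)) := eps v + iot v

/-- `c̃(v) = a·ε(v) - b·ι(v)`. -/
def cTil (a b : ℝ) (v : EuclideanSpace ℝ (Fin 4)) := a • eps v - b • iot v

/-- The zeroth-order symbol
`p₀ = -(h/4)·Σᵢ c̃(eᵢ)∘ĉ(eᵢ)∘ĉ(e₄) + (h/4)·Σᵢ c̃(eᵢ)∘c(eᵢ)∘c(e₄)`. -/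
def p0 (a b h : ℝ) :
    ExteriorAlgebra ℝ (EuclideanSpace ℝ (Fin 4)) →ₗ[ℝ]
      ExteriorAlgebra ℝ (EuclideanSpace ℝ (Fin 4)) :=
  (-(h / 4)) • ∑ i : Fin 3,
      (cTil a b (stdBasis i.castSucc) ∘ₗ cHat (stdBasis i.castSucc) ∘ₗ cHat (stdBasis 3))
    + (h / 4) • ∑ i : Fin 3,
      (cTil a b (stdBasis i.castSucc) ∘ₗ cOp (stdBasis i.castSucc) ∘ₗ cOp (stdBasis 3))

abbrev EA := ExteriorAlgebra ℝ (EuclideanSpace ℝ (Fin 4))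

lemma eps_eps (u v : EuclideanSpace ℝ (Fin 4)) :
    (eps u * eps v : Module.End ℝ EA) = -(eps v * eps u) := by
  refine LinearMap.ext fun x => ?_
  change ExteriorAlgebra.ι ℝ u * (ExteriorAlgebra.ι ℝ v * x) =
    -(ExteriorAlgebra.ι ℝ v * (ExteriorAlgebra.ι ℝ u * x))
  rw [← mul_assoc, ← mul_assoc, eq_neg_of_add_eq_zero_left (ExteriorAlgebra.ι_add_mul_swap (R := ℝ) u v), neg_mul]

lemma iot_iot (u v : EuclideanSpace ℝ (Fin 4)) :
    (iot u * iot v : Module.End ℝ EA) = -(iot v * iot u) := by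
  refine LinearMap.ext fun x => ?_
  exact CliffordAlgebra.contractLeft_comm _ _ x

lemma iot_eps (u v : EuclideanSpace ℝ (Fin 4)) :
    (iot u * eps v : Module.End ℝ EA) = (inner ℝ u v) • (1 : Module.End ℝ EA) - eps v * iot u := by
  refine LinearMap.ext fun x => ?_
  exact CliffordAlgebra.contractLeft_ι_mul _ _ x

lemma eps_sq (u : EuclideanSpace ℝ (Fin 4)) : (eps u * eps u : Module.End ℝ EA) = 0 := by
  refine LinearMap.ext fun x => ?_
  change ExteriorAlgebra.ι ℝ u * (ExteriorAlgebra.ι ℝ u * x) = 0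
  rw [← mul_assoc, ExteriorAlgebra.ι_sq_zero, zero_mul]

lemma iot_sq (u : EuclideanSpace ℝ (Fin 4)) : (iot u * iot u : Module.End ℝ EA) = 0 := by
  refine LinearMap.ext fun x => ?_
  exact CliffordAlgebra.contractLeft_contractLeft _ x

lemma trace_one_EA : LinearMap.trace ℝ EA 1 = 16 := by
  have B := (EuclideanSpace.basisFun (Fin 4) ℝ).toBasis.ExteriorAlgebra
  have : Module.Finite ℝ EA := Module.Finite.of_basis B
  have : Module.Free ℝ EA := Module.Free.of_basis B
  rw [LinearMap.trace_one, Module.finrank_eq_card_basis B]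
  simp

lemma trace_four {A : Type*} [Ring A] [Algebra ℝ A] (τ : A →ₗ[ℝ] ℝ)
    (hτ : ∀ x y, τ (x * y) = τ (y * x)) (hone : τ 1 = 16)
    (e f E I : A) (hef : f * e = 1 - e * f) (hEI : I * E = 1 - E * I)
    (heE : E * e = -(e * E)) (heI : I * e = -(e * I)) :
    τ (e * f * (E * I)) = 4 := by
  have h1 : τ (E * I) = 8 := by
    have := hτ E I
    rw [hEI, map_sub, hone] at this
    linarith
  have h2 : τ (e * f * (E * I)) = τ (f * e * (E * I)) := by
    rw [mul_assoc, hτ]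
    congr 1
    have : E * I * e = e * (E * I) := by
      rw [mul_assoc, heI, mul_neg, ← mul_assoc, heE, neg_mul, neg_neg, mul_assoc]
    rw [mul_assoc, this, mul_assoc]
  rw [hef, sub_mul, map_sub, one_mul, h1] at h2
  linarith

lemma trace_term {A : Type*} [Ring A] [Algebra ℝ A] (τ : A →ₗ[ℝ] ℝ)
    (hτ : ∀ x y, τ (x * y) = τ (y * x)) (hone : τ 1 = 16)
    (a b h : ℝ) (C e f E I : A) (hef : f * e = 1 - e * f)
    (hEI : I * E = 1 - E * I) (heE : E * e = -(e * E)) (heI : I * e = -(e * I))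
    (he : e * e = 0) (hf : f * f = 0) (hI : I * I = 0)
    (hCE : E * C = -(C * E)) (hCI : I * C = -(C * I)) (hC : C * C = (-(a * b)) • 1) :
    τ (C * ((-(h / 4)) • ((a • e - b • f) * ((e + f) * (E + I))) +
      (h / 4) • ((a • e - b • f) * ((e - f) * (E - I)))) * C * I) = -(2 * a ^ 2 * b * h) := by
  have key : (-(h / 4)) • ((a • e - b • f) * ((e + f) * (E + I))) +
      (h / 4) • ((a • e - b • f) * ((e - f) * (E - I))) =
      (-(h / 2) * a) • (e * f * E) + (h / 2 * b) • (f * e * I) := by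
    have h1 : (a • e - b • f) * (e + f) = a • (e * f) - b • (f * e) := by
      simp only [sub_mul, mul_add, smul_mul_assoc, he, hf]; module
    have h2 : (a • e - b • f) * (e - f) = -(a • (e * f)) - b • (f * e) := by
      simp only [sub_mul, mul_sub, smul_mul_assoc, he, hf]; module
    rw [← mul_assoc, ← mul_assoc, h1, h2]
    simp only [sub_mul, mul_add, mul_sub, smul_mul_assoc, neg_mul]
    module
  have t1 : C * (f * e * I) * C * I = 0 := by
    have : C * (f * e * I) * C * I = C * (f * e) * (I * C) * I := by noncomm_ring
    rw [this, hCI]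
    have : C * (f * e) * (-(C * I)) * I = -(C * (f * e) * C * (I * I)) := by noncomm_ring
    rw [this, hI]; simp
  have t2 : τ (C * (e * f * E) * C * I) = 4 * (a * b) := by
    have h1 : C * (e * f * E) * C * I = C * (e * f * (E * C) * I) := by noncomm_ring
    rw [h1, hCE, hτ]
    have h2 : e * f * (-(C * E)) * I * C = -(e * f * C * E * (I * C)) := by noncomm_ring
    rw [h2, hCI]
    have h3 : -(e * f * C * E * (-(C * I))) = e * f * C * (E * C) * I := by noncomm_ring
    rw [h3, hCE]
    have h4 : e * f * C * (-(C * E)) * I = -(e * f * (C * C) * (E * I)) := by noncomm_ring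
    rw [h4, hC]
    simp only [mul_smul_comm, smul_mul_assoc, mul_one, map_neg, map_smul,
      trace_four τ hτ hone e f E I hef hEI heE heI, smul_eq_mul]
    ring
  rw [key]
  simp only [mul_add, add_mul, mul_smul_comm, smul_mul_assoc, map_add, map_smul, t1, t2,
    map_zero, smul_eq_mul]
  ring

theorem trace_cTil_xi_p0_cTil_xi_iot_e4 (a b h : ℝ) (hab : a * b ≠ 0)
    (ξ' : EuclideanSpace ℝ (Fin 4))
    (hspan : ξ' ∈ Submodule.span ℝ {stdBasis 0, stdBasis 1, stdBasis 2})
    (hξ : ‖ξ'‖ = 1) :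
    LinearMap.trace ℝ _ (cTil a b ξ' ∘ₗ p0 a b h ∘ₗ cTil a b ξ' ∘ₗ iot (stdBasis 3)) = -(6 * a ^ 2 * b * h) := by
  have h0 : inner ℝ (stdBasis 3) ξ' = 0 := by
    clear hξ
    induction hspan using Submodule.span_induction with
    | mem x hx =>
      rcases hx with rfl | rfl | rfl <;> simp [stdBasis, EuclideanSpace.inner_single_left]
    | zero => simp
    | add x y _ _ hx hy => rw [inner_add_right, hx, hy, add_zero]
    | smul c x _ hx => rw [inner_smul_right, hx, mul_zero]
  have h0' : inner ℝ ξ' (stdBasis 3) = 0 := by rw [real_inner_comm, h0]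
  have h1 : inner ℝ ξ' ξ' = 1 := by rw [real_inner_self_eq_norm_sq, hξ]; norm_num
  have hn : ∀ i, inner ℝ (stdBasis i) (stdBasis i) = 1 := by
    intro i; simp [stdBasis]
  have ho : ∀ i : Fin 3, inner ℝ (stdBasis 3) (stdBasis i.castSucc) = 0 := by
    intro i; fin_cases i <;> simp [stdBasis, EuclideanSpace.inner_single_left]
  have hc : cTil a b ξ' ∘ₗ p0 a b h ∘ₗ cTil a b ξ' ∘ₗ iot (stdBasis 3) =
      ∑ i : Fin 3, (cTil a b ξ' : Module.End ℝ EA) * ((-(h / 4)) •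
        ((a • eps (stdBasis i.castSucc) - b • iot (stdBasis i.castSucc) : Module.End ℝ EA) *
          ((eps (stdBasis i.castSucc) + iot (stdBasis i.castSucc)) *
            (eps (stdBasis 3) + iot (stdBasis 3)))) +
      (h / 4) • ((a • eps (stdBasis i.castSucc) - b • iot (stdBasis i.castSucc)) *
          ((eps (stdBasis i.castSucc) - iot (stdBasis i.castSucc)) *
            (eps (stdBasis 3) - iot (stdBasis 3))))) * cTil a b ξ' * iot (stdBasis 3) := by
    rw [← Finset.sum_mul, ← Finset.sum_mul, ← Finset.mul_sum, Finset.sum_add_distrib,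
      ← Finset.smul_sum, ← Finset.smul_sum]
    rfl
  rw [hc, map_sum, Finset.sum_congr rfl (fun i _ => trace_term (A := Module.End ℝ EA)
    (LinearMap.trace ℝ EA) (LinearMap.trace_mul_comm ℝ) trace_one_EA a b h _ _ _ _ _ ?_ ?_ ?_ ?_ ?_ ?_ ?_ ?_ ?_ ?_)]
  · simp; ring
  · rw [iot_eps, hn, one_smul]
  · rw [iot_eps, hn, one_smul]
  · exact eps_eps _ _
  · rw [iot_eps, ho, zero_smul, zero_sub]
  · exact eps_sq _
  · exact iot_sq _
  · exact iot_sq _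
  · have h2 := iot_eps ξ' (stdBasis 3)
    rw [h0', zero_smul, zero_sub] at h2
    simp only [cTil, mul_sub, sub_mul, mul_smul_comm, smul_mul_assoc, h2, eps_eps (stdBasis 3) ξ']
    module
  · have h2 := iot_eps (stdBasis 3) ξ'
    rw [h0, zero_smul, zero_sub] at h2
    simp only [cTil, mul_sub, sub_mul, mul_smul_comm, smul_mul_assoc, h2, iot_iot (stdBasis 3) ξ']
    module
  · have h2 := iot_eps ξ' ξ'
    rw [h1, one_smul] at h2
    simp only [cTil, mul_sub, sub_mul, mul_smul_comm, smul_mul_assoc, h2, eps_sq, iot_sq]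
    module
end
end

section
/- With the notation of the context (endomorphisms of Λ*(ℝ⁴), real numbers a,b with ab≠0, real parameter h, and zeroth-order symbol p₀), one has tr[c̃(e₄)∘p₀∘c̃(e₄)∘ε(e₄)] = −6ab²h. -/
open scoped BigOperators

noncomputable section

section Aux


/-- The algebraic identity behind the computation, in any algebra with the CAR relations. -/
lemma aux_alg {A : Type*} [Ring A] [Algebra ℝ A] (a b h : ℝ) (e j E I : A)
    (hee : e * e = 0) (hjj : j * j = 0) (hEE : E * E = 0) (hII : I * I = 0)
    (hIE : I * E + E * I = 1)
    (hEe : E * e = -(e * E)) (hEj : E * j = -(j * E))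
    (hIe : I * e = -(e * I)) (hIj : I * j = -(j * I)) :
    (a • E - b • I) * (((-(h / 4)) • ((a • e - b • j) * ((e + j) * (E + I)))
      + (h / 4) • ((a • e - b • j) * ((e - j) * (E - I)))) * ((a • E - b • I) * E))
      = (-(a * b ^ 2 * h / 2)) • (e * j * (I * E)) := by
  have h1 : (a • E - b • I) * E = (-b) • (I * E) := by
    simp [sub_mul, hEE]
  have h2 : E * (I * E) = E := by
    rw [eq_sub_of_add_eq hIE, mul_sub, mul_one, ← mul_assoc, hEE, zero_mul, sub_zero]
  have h3 : I * (I * E) = 0 := by rw [← mul_assoc, hII, zero_mul]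
  have h4 : (a • e - b • j) * (e + j) = a • (e * j) - b • (j * e) := by
    simp [sub_mul, mul_add, hee, hjj]
    abel
  have h5 : (a • e - b • j) * (e - j) = -(a • (e * j)) - b • (j * e) := by
    simp [sub_mul, mul_sub, hee, hjj]
    abel
  have h6 : E * (e * j) = e * j * E := by
    rw [← mul_assoc, hEe, neg_mul, mul_assoc, hEj, mul_neg, neg_neg, mul_assoc]
  have h7 : I * (e * j) = e * j * I := by
    rw [← mul_assoc, hIe, neg_mul, mul_assoc, hIj, mul_neg, neg_neg, mul_assoc]
  have h8 : ((-(h / 4)) • ((a • e - b • j) * ((e + j) * (E + I)))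
      + (h / 4) • ((a • e - b • j) * ((e - j) * (E - I)))) * (I * E)
      = (-(a * h / 2)) • (e * j * E) := by
    rw [← mul_assoc (a • e - b • j) (e + j), ← mul_assoc (a • e - b • j) (e - j), h4, h5,
      add_mul, smul_mul_assoc, smul_mul_assoc, mul_assoc _ (E + I), mul_assoc _ (E - I),
      add_mul, sub_mul E I, h2, h3, add_zero, sub_zero, sub_mul, sub_mul, neg_mul,
      smul_mul_assoc, smul_mul_assoc]
    module
  have h9 : (a • E - b • I) * (e * j * E) = (-b) • (e * j * (I * E)) := by
    rw [← mul_assoc, sub_mul, smul_mul_assoc, smul_mul_assoc, h6, h7, sub_mul, smul_mul_assoc,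
      smul_mul_assoc, mul_assoc _ E E, hEE, mul_assoc _ I E, mul_zero, smul_zero, zero_sub, neg_smul]
  rw [h1, mul_smul_comm, h8, smul_smul, mul_smul_comm, h9, smul_smul]
  congr 1
  ring

lemma aux_comm {A : Type*} [Ring A] (e E I : A) (k4 : E * e = -(e * E))
    (k3 : I * e + e * I = 0) : I * E * e = e * (I * E) := by
  rw [mul_assoc, k4, mul_neg, ← mul_assoc, eq_neg_of_add_eq_zero_left k3, neg_mul, neg_neg,
    mul_assoc]

lemma aux_EE (v : (EuclideanSpace ℝ (Fin 4))) : (eps v * eps v : Module.End ℝ (ExteriorAlgebra ℝ (EuclideanSpace ℝ (Fin 4)))) = 0 := by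
  apply LinearMap.ext
  intro x
  simp [eps, ← mul_assoc]

lemma aux_EEc (v w : (EuclideanSpace ℝ (Fin 4))) : (eps v * eps w : Module.End ℝ (ExteriorAlgebra ℝ (EuclideanSpace ℝ (Fin 4)))) = -(eps w * eps v) := by
  apply LinearMap.ext
  intro x
  have := ExteriorAlgebra.ι_add_mul_swap (R := ℝ) v w
  simp only [eps, Module.End.mul_apply, LinearMap.mulLeft_apply, LinearMap.neg_apply, ← mul_assoc]
  rw [eq_neg_of_add_eq_zero_left this, neg_mul]

lemma aux_II (v : (EuclideanSpace ℝ (Fin 4))) : (iot v * iot v : Module.End ℝ (ExteriorAlgebra ℝ (EuclideanSpace ℝ (Fin 4)))) = 0 := by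
  apply LinearMap.ext
  intro x
  exact CliffordAlgebra.contractLeft_contractLeft _ x

lemma aux_IIc (v w : (EuclideanSpace ℝ (Fin 4))) : (iot v * iot w : Module.End ℝ (ExteriorAlgebra ℝ (EuclideanSpace ℝ (Fin 4)))) = -(iot w * iot v) := by
  apply LinearMap.ext
  intro x
  exact CliffordAlgebra.contractLeft_comm _ _ x

lemma aux_IE (v w : (EuclideanSpace ℝ (Fin 4))) : (iot v * eps w + eps w * iot v : Module.End ℝ (ExteriorAlgebra ℝ (EuclideanSpace ℝ (Fin 4))))
    = (inner ℝ v w : ℝ) • 1 := by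
  apply LinearMap.ext
  intro x
  have := CliffordAlgebra.contractLeft_ι_mul (Q := (0 : QuadraticForm ℝ (EuclideanSpace ℝ (Fin 4))))
    ((innerSL ℝ v).toLinearMap) w x
  exact eq_sub_iff_add_eq.mp this

lemma aux_inner (i j : Fin 4) : (inner ℝ (stdBasis i) (stdBasis j) : ℝ) = if i = j then 1 else 0 := by
  rw [stdBasis, stdBasis, EuclideanSpace.inner_single_left]
  simp [Pi.single_apply]

lemma aux_tr_one : LinearMap.trace ℝ (ExteriorAlgebra ℝ (EuclideanSpace ℝ (Fin 4))) (1 : Module.End ℝ (ExteriorAlgebra ℝ (EuclideanSpace ℝ (Fin 4)))) = 16 := by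
  let B := (EuclideanSpace.basisFun (Fin 4) ℝ).toBasis.ExteriorAlgebra
  have : Module.Finite ℝ (ExteriorAlgebra ℝ (EuclideanSpace ℝ (Fin 4))) := Module.Finite.of_basis B
  rw [LinearMap.trace_one, Module.finrank_eq_card_basis B]
  simp

lemma aux_tr (i : Fin 3) : LinearMap.trace ℝ (ExteriorAlgebra ℝ (EuclideanSpace ℝ (Fin 4)))
    ((eps (stdBasis i.castSucc) * iot (stdBasis i.castSucc) *
      (iot (stdBasis 3) * eps (stdBasis 3)) : Module.End ℝ (ExteriorAlgebra ℝ (EuclideanSpace ℝ (Fin 4))))) = 4 := by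
  have hne : i.castSucc ≠ 3 := (Fin.castSucc_lt_last i).ne
  have k1 := aux_IE (stdBasis i.castSucc) (stdBasis i.castSucc)
  have k2 := aux_IE (stdBasis 3) (stdBasis 3)
  have k3 := aux_IE (stdBasis 3) (stdBasis i.castSucc)
  have k4 := aux_EEc (stdBasis 3) (stdBasis i.castSucc)
  rw [aux_inner, if_pos rfl, one_smul] at k1 k2
  rw [aux_inner, if_neg hne.symm, zero_smul] at k3
  generalize (eps (stdBasis i.castSucc) : Module.End ℝ (ExteriorAlgebra ℝ (EuclideanSpace ℝ (Fin 4)))) = e at *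
  generalize (iot (stdBasis i.castSucc) : Module.End ℝ (ExteriorAlgebra ℝ (EuclideanSpace ℝ (Fin 4)))) = j at *
  generalize (eps (stdBasis 3) : Module.End ℝ (ExteriorAlgebra ℝ (EuclideanSpace ℝ (Fin 4)))) = E at *
  generalize (iot (stdBasis 3) : Module.End ℝ (ExteriorAlgebra ℝ (EuclideanSpace ℝ (Fin 4)))) = I at *
  have t1 : LinearMap.trace ℝ (ExteriorAlgebra ℝ (EuclideanSpace ℝ (Fin 4))) (I * E) = 8 := by
    have := congrArg (LinearMap.trace ℝ (ExteriorAlgebra ℝ (EuclideanSpace ℝ (Fin 4)))) k2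
    rw [map_add, LinearMap.trace_mul_comm ℝ E I, aux_tr_one] at this
    linarith
  have c : I * E * e = e * (I * E) := aux_comm e E I k4 k3
  have t2 : LinearMap.trace ℝ (ExteriorAlgebra ℝ (EuclideanSpace ℝ (Fin 4))) (e * j * (I * E)) = LinearMap.trace ℝ (ExteriorAlgebra ℝ (EuclideanSpace ℝ (Fin 4))) (j * e * (I * E)) := by
    rw [mul_assoc, LinearMap.trace_mul_comm, mul_assoc, c, mul_assoc]
  have t3 := congrArg (fun x => LinearMap.trace ℝ (ExteriorAlgebra ℝ (EuclideanSpace ℝ (Fin 4))) (x * (I * E))) k1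
  simp only [add_mul, map_add, one_mul] at t3
  linarith

end Aux

theorem trace_cTil_e4_p0_cTil_e4_eps_e4 (a b h : ℝ) (hab : a * b ≠ 0) :
    LinearMap.trace ℝ _ (cTil a b (stdBasis 3) ∘ₗ p0 a b h ∘ₗ cTil a b (stdBasis 3) ∘ₗ eps (stdBasis 3)) = -(6 * a * b ^ 2 * h) := by
  have key : (cTil a b (stdBasis 3) ∘ₗ p0 a b h ∘ₗ cTil a b (stdBasis 3) ∘ₗ eps (stdBasis 3))
      = ∑ i : Fin 3, (-(a * b ^ 2 * h / 2)) •
        (eps (stdBasis i.castSucc) * iot (stdBasis i.castSucc) *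
          (iot (stdBasis 3) * eps (stdBasis 3)) :
          Module.End ℝ (ExteriorAlgebra ℝ (EuclideanSpace ℝ (Fin 4)))) := by
    simp only [p0, ← Module.End.mul_eq_comp]
    rw [Finset.smul_sum, Finset.smul_sum, ← Finset.sum_add_distrib, Finset.sum_mul,
      Finset.mul_sum]
    refine Finset.sum_congr rfl fun i _ => ?_
    have hne : i.castSucc ≠ 3 := (Fin.castSucc_lt_last i).ne
    have k2 := aux_IE (stdBasis 3) (stdBasis 3)
    have k3 := aux_IE (stdBasis 3) (stdBasis i.castSucc)
    have k4 := aux_IE (stdBasis i.castSucc) (stdBasis 3)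
    rw [aux_inner, if_pos rfl, one_smul] at k2
    rw [aux_inner, if_neg hne.symm, zero_smul] at k3
    rw [aux_inner, if_neg hne, zero_smul] at k4
    exact aux_alg a b h _ _ _ _ (aux_EE _) (aux_II _) (aux_EE _) (aux_II _) k2
      (aux_EEc _ _) (eq_neg_of_add_eq_zero_right k4) (eq_neg_of_add_eq_zero_left k3) (aux_IIc _ _)
  rw [key, map_sum]
  simp only [map_smul, aux_tr]
  simp
  ring
end
end
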